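/- Let n ≥ 0 and let (A^{•,•}, ∂, ∂̄) be a bounded double complex of finite-dimensional vector spaces over ℂ equipped with a real structure, such that A^{p,q} = 0 unless 0 ≤ p ≤ n and 0 ≤ q ≤ n. Then for every k ∈ ℤ: Σ_{p+q=k} dim_ℂ H_A^{p,q} ≤ min{k+1, (2n−k)+1} · ( Σ_{p+q=k} dim_ℂ H_∂̄^{p,q} + Σ_{p+q=k+1} dim_ℂ H_∂̄^{p,q} ), and in particular the left-hand side is ≤ (n+1) · ( Σ_{p+q=k} dim_ℂ H_∂̄^{p,q} + Σ_{p+q=k+1} dim_ℂ H_∂̄^{p,q} ). (Upper bound for the Aeppli numbers in terms of the Hodge numbers, Angella–Tardini.) -/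

import Mathlib

open LinearMap Submodule Module DirectSum

namespace Paper

section DoubleComplex

variable (K : Type) [Field K]
variable (A : ℤ → ℤ → Type) [∀ p q, AddCommGroup (A p q)] [∀ p q, Module K (A p q)]

/-- Transport along equalities of the indices. -/
def dcCast {p q p' q' : ℤ} (h1 : p = p') (h2 : q = q') : A p q ≃ₗ[K] A p' q' := by
  subst h1; subst h2; exact LinearEquiv.refl K (A p q)

variable (d1 : ∀ p q : ℤ, A p q →ₗ[K] A (p + 1) q)
variable (d2 : ∀ p q : ℤ, A p q →ₗ[K] A p (q + 1))

/-- The operator ∂∂̄ : A^{p,q} → A^{p+1,q+1} (apply ∂̄ first, then ∂). -/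
def ddBar (p q : ℤ) : A p q →ₗ[K] A (p + 1) (q + 1) := (d1 p (q + 1)).comp (d2 p q)

/-- The image ∂∂̄(A^{p-1,q-1}) inside A^{p,q}. -/
def ddBarIm (p q : ℤ) : Submodule K (A p q) :=
  range ((dcCast K A (show p - 1 + 1 = p by ring) (show q - 1 + 1 = q by ring)).toLinearMap.comp
    (ddBar K A d1 d2 (p - 1) (q - 1)))

/-- Bott-Chern cohomology H_BC^{p,q} = (ker ∂ ∩ ker ∂̄)/∂∂̄(A^{p-1,q-1}). -/
abbrev HBC (p q : ℤ) :=
  ↥(ker (d1 p q) ⊓ ker (d2 p q)) ⧸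
    ((ddBarIm K A d1 d2 p q).comap (ker (d1 p q) ⊓ ker (d2 p q)).subtype)

noncomputable def hBC (p q : ℤ) : ℕ := finrank K (HBC K A d1 d2 p q)

/-- ∂(A^{p-1,q}) + ∂̄(A^{p,q-1}) inside A^{p,q}. -/
def aDen (p q : ℤ) : Submodule K (A p q) :=
  range ((dcCast K A (show p - 1 + 1 = p by ring) rfl).toLinearMap.comp (d1 (p - 1) q)) ⊔
  range ((dcCast K A rfl (show q - 1 + 1 = q by ring)).toLinearMap.comp (d2 p (q - 1)))

/-- Aeppli cohomology H_A^{p,q} = ker ∂∂̄ / (im ∂ + im ∂̄). -/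
abbrev HA (p q : ℤ) :=
  ↥(ker (ddBar K A d1 d2 p q)) ⧸ ((aDen K A d1 d2 p q).comap (ker (ddBar K A d1 d2 p q)).subtype)

noncomputable def hA (p q : ℤ) : ℕ := finrank K (HA K A d1 d2 p q)

/-- Column (Dolbeault) cohomology H_∂̄^{p,q}. -/
abbrev HDolb (p q : ℤ) :=
  ↥(ker (d2 p q)) ⧸
    ((range ((dcCast K A rfl (show q - 1 + 1 = q by ring)).toLinearMap.comp (d2 p (q - 1)))).comap
      (ker (d2 p q)).subtype)

noncomputable def hDolb (p q : ℤ) : ℕ := finrank K (HDolb K A d2 p q)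

/-- Row cohomology H_∂^{p,q}. -/
abbrev HRow (p q : ℤ) :=
  ↥(ker (d1 p q)) ⧸
    ((range ((dcCast K A (show p - 1 + 1 = p by ring) rfl).toLinearMap.comp (d1 (p - 1) q))).comap
      (ker (d1 p q)).subtype)

noncomputable def hRow (p q : ℤ) : ℕ := finrank K (HRow K A d1 p q)

/-- Total complex Tot^k = ⊕_{p+q=k} A^{p,q}. -/
abbrev Tot (k : ℤ) := ⨁ p : ℤ, A p (k - p)

/-- Total differential d = ∂ + ∂̄ on the total complex. -/
noncomputable def totD (k : ℤ) : Tot A k →ₗ[K] Tot A (k + 1) :=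
  DirectSum.toModule K ℤ (Tot A (k + 1)) fun p =>
    ((DirectSum.lof K ℤ (fun p' => A p' (k + 1 - p')) (p + 1)).comp
      ((dcCast K A rfl (show k - p = k + 1 - (p + 1) by ring)).toLinearMap.comp (d1 p (k - p))))
    +
    ((DirectSum.lof K ℤ (fun p' => A p' (k + 1 - p')) p).comp
      ((dcCast K A rfl (show k - p + 1 = k + 1 - p by ring)).toLinearMap.comp (d2 p (k - p))))

def totCast {k k' : ℤ} (h : k = k') : Tot A k ≃ₗ[K] Tot A k' := by
  subst h; exact LinearEquiv.refl K (Tot A k)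

/-- b_k = dim H^k(Tot, d). -/
noncomputable def bNum (k : ℤ) : ℕ :=
  finrank K
    (↥(ker (totD K A d1 d2 k)) ⧸
      ((range ((totCast K A (show k - 1 + 1 = k by ring)).toLinearMap.comp
        (totD K A d1 d2 (k - 1)))).comap (ker (totD K A d1 d2 k)).subtype))

/-- The ∂∂̄-lemma: ker ∂ ∩ ker ∂̄ ∩ (im ∂ + im ∂̄) ⊆ im ∂∂̄ in each bidegree. -/
def DDbarLemma : Prop :=
  ∀ p q : ℤ, (ker (d1 p q) ⊓ ker (d2 p q)) ⊓ aDen K A d1 d2 p q ≤ ddBarIm K A d1 d2 p q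

end DoubleComplex

/-- The map between sub-quotients induced by the identity. -/
def qMap (K : Type) [Field K] {V : Type} [AddCommGroup V] [Module K V]
    {N1 N2 M1 M2 : Submodule K V} (hN : N1 ≤ N2) (hM : M1 ≤ M2) :
    (↥N1 ⧸ M1.comap N1.subtype) →ₗ[K] (↥N2 ⧸ M2.comap N2.subtype) :=
  Submodule.mapQ _ _ (Submodule.inclusion hN) (by
    intro x hx
    simp only [Submodule.mem_comap, Submodule.coe_subtype] at hx ⊢
    simpa using hM hx)

section SComplex

variable (K : Type) [Field K]
variable (A : ℤ → Type) [∀ k, AddCommGroup (A k)] [∀ k, Module K (A k)]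

def sCast {k k' : ℤ} (h : k = k') : A k ≃ₗ[K] A k' := by
  subst h; exact LinearEquiv.refl K (A k)

variable (d : ∀ k : ℤ, A k →ₗ[K] A (k + 1))
variable (dl : ∀ k : ℤ, A k →ₗ[K] A (k - 1))

/-- The degree-0 operator dδ : A^k → A^k (apply δ first, then d). -/
def dDelta (k : ℤ) : A k →ₗ[K] A k :=
  (sCast K A (show k - 1 + 1 = k by ring)).toLinearMap.comp ((d (k - 1)).comp (dl k))

/-- Symplectic-type Bott-Chern cohomology H_BC^k = (ker d ∩ ker δ)/dδ(A^k). -/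
abbrev HBCs (k : ℤ) :=
  ↥(ker (d k) ⊓ ker (dl k)) ⧸
    ((range (dDelta K A d dl k)).comap (ker (d k) ⊓ ker (dl k)).subtype)

noncomputable def hBCs (k : ℤ) : ℕ := finrank K (HBCs K A d dl k)

/-- d(A^{k-1}) + δ(A^{k+1}) inside A^k. -/
def sDen (k : ℤ) : Submodule K (A k) :=
  range ((sCast K A (show k - 1 + 1 = k by ring)).toLinearMap.comp (d (k - 1))) ⊔
  range ((sCast K A (show k + 1 - 1 = k by ring)).toLinearMap.comp (dl (k + 1)))

/-- Symplectic-type Aeppli cohomology H_A^k = ker dδ / (im d + im δ). -/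
abbrev HAs (k : ℤ) :=
  ↥(ker (dDelta K A d dl k)) ⧸ ((sDen K A d dl k).comap (ker (dDelta K A d dl k)).subtype)

noncomputable def hAs (k : ℤ) : ℕ := finrank K (HAs K A d dl k)

/-- H_d^k = ker d / im d. -/
abbrev Hds (k : ℤ) :=
  ↥(ker (d k)) ⧸
    ((range ((sCast K A (show k - 1 + 1 = k by ring)).toLinearMap.comp (d (k - 1)))).comap
      (ker (d k)).subtype)

noncomputable def hds (k : ℤ) : ℕ := finrank K (Hds K A d k)

/-- H_δ^k = ker δ / im δ. -/
abbrev Hdls (k : ℤ) :=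
  ↥(ker (dl k)) ⧸
    ((range ((sCast K A (show k + 1 - 1 = k by ring)).toLinearMap.comp (dl (k + 1)))).comap
      (ker (dl k)).subtype)

noncomputable def hdls (k : ℤ) : ℕ := finrank K (Hdls K A dl k)

/-- The dδ-lemma: ker d ∩ ker δ ∩ (im d + im δ) ⊆ im dδ in each degree. -/
def DDeltaLemma : Prop :=
  ∀ k : ℤ, (ker (d k) ⊓ ker (dl k)) ⊓ sDen K A d dl k ≤ range (dDelta K A d dl k)

/-- The strip double complex B^{p,q} = A^{p-q}. -/
abbrev strip (p q : ℤ) := A (p - q)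

/-- ∂ on the strip double complex, given by d. -/
def stripD1 (p q : ℤ) : strip A p q →ₗ[K] strip A (p + 1) q :=
  (sCast K A (show p - q + 1 = p + 1 - q by ring)).toLinearMap.comp (d (p - q))

/-- ∂̄ on the strip double complex, given by δ. -/
def stripD2 (p q : ℤ) : strip A p q →ₗ[K] strip A p (q + 1) :=
  (sCast K A (show p - q - 1 = p - (q + 1) by ring)).toLinearMap.comp (dl (p - q))

end SComplex

section QuotientDimensions

variable {K : Type} [Field K] {V : Type} [AddCommGroup V] [Module K V] [FiniteDimensional K V]

theorem finrank_subquotient_add {M N : Submodule K V} (h : M ≤ N) :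
    finrank K (↥N ⧸ M.comap N.subtype) + finrank K M = finrank K N := by
  have h1 := Submodule.finrank_quotient_add_finrank (M.comap N.subtype)
  rwa [(Submodule.comapSubtypeEquivOfLe h).finrank_eq] at h1

theorem finrank_map_add_finrank_ker {W : Type} [AddCommGroup W] [Module K W]
    (f : V →ₗ[K] W) {N : Submodule K V} (h : ker f ≤ N) :
    finrank K (N.map f) + finrank K (ker f) = finrank K N := by
  have h1 := LinearMap.finrank_range_add_finrank_ker (f.domRestrict N)
  rwa [LinearMap.range_domRestrict, LinearMap.ker_domRestrict,
    (Submodule.comapSubtypeEquivOfLe h).finrank_eq] at h1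

theorem finrank_comap_eq {W : Type} [AddCommGroup W] [Module K W]
    (f : V →ₗ[K] W) (I : Submodule K W) :
    finrank K (I.comap f) = finrank K ↥(range f ⊓ I) + finrank K (ker f) := by
  rw [← finrank_map_add_finrank_ker f (LinearMap.ker_le_comap f), Submodule.map_comap_eq]

theorem finrank_sup_range {U W : Type} [AddCommGroup U] [Module K U]
    [AddCommGroup W] [Module K W] (e : U →ₗ[K] V) (f : V →ₗ[K] W) :
    finrank K ↥(ker f ⊔ range e) = finrank K (range (f.comp e)) + finrank K (ker f) := by
  have h : ker f ⊔ range e = (range (f.comp e)).comap f := by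
    rw [LinearMap.range_comp, Submodule.comap_map_eq, sup_comm]
  rw [h, finrank_comap_eq, inf_eq_right.2 (LinearMap.range_comp_le_range e f)]

/-- One step along a zigzag: the Aeppli-type quotient of `X` is controlled by the cohomologies at
`X` and `B` and the Aeppli-type quotient of `Y`, for an anticommuting square with vertices
`E`, `X`, `Y`, `B`, continued by `g'` after `B`. -/
theorem finrank_zigzag_step {E X Y B C : Type}
    [AddCommGroup E] [Module K E] [AddCommGroup X] [Module K X] [FiniteDimensional K X]
    [AddCommGroup Y] [Module K Y] [FiniteDimensional K Y]
    [AddCommGroup B] [Module K B] [FiniteDimensional K B] [AddCommGroup C] [Module K C]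
    (e : E →ₗ[K] X) (e' : E →ₗ[K] Y) (f : X →ₗ[K] B) (g : Y →ₗ[K] B) (g' : B →ₗ[K] C)
    (hfg : ∀ x, f (e x) + g (e' x) = 0) (hg : range g ≤ ker g')
    (R : Submodule K X) (hR : R ≤ ker f) (S : Submodule K Y) (hS : S ≤ ker g)
    (T : Submodule K Y) (hT : (range f).comap g ≤ T) :
    finrank K (ker (g'.comp f)) + finrank K R + finrank K (range g)
        + finrank K ↥(range e' ⊔ S) ≤
      finrank K ↥(R ⊔ range e) + finrank K (ker f) + finrank K (ker g') + finrank K T := by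
  have hcomp : range (f.comp e) = range (g.comp e') := by
    have h : f.comp e = -(g.comp e') := by
      ext x
      exact eq_neg_of_add_eq_zero_left (hfg x)
    rw [h, LinearMap.range_neg]
  have hX := finrank_sup_range e f
  have hY := finrank_sup_range e' g
  have hI := finrank_comap_eq g (range f)
  have hTle := Submodule.finrank_mono hT
  have hSle : finrank K ↥(range e' ⊔ S) ≤ finrank K ↥(ker g ⊔ range e') :=
    Submodule.finrank_mono (sup_le le_sup_right (hS.trans le_sup_left))
  have hZ : finrank K (ker (g'.comp f)) = finrank K ↥(range f ⊓ ker g') + finrank K (ker f) := by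
    rw [LinearMap.ker_comp, finrank_comap_eq]
  have hB := Submodule.finrank_sup_add_finrank_inf_eq (range f ⊓ ker g') (range g)
  have hBsup : finrank K ↥(range f ⊓ ker g' ⊔ range g) ≤ finrank K (ker g') :=
    Submodule.finrank_mono (sup_le inf_le_right hg)
  have hBinf : range f ⊓ ker g' ⊓ range g = range g ⊓ range f := by
    rw [inf_assoc, inf_eq_right.2 hg, inf_comm]
  rw [hBinf] at hB
  have hQ := Submodule.finrank_sup_add_finrank_inf_eq (ker f) (R ⊔ range e)
  rw [← sup_assoc, sup_eq_left.2 hR] at hQ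
  have hRle : finrank K R ≤ finrank K ↥(ker f ⊓ (R ⊔ range e)) :=
    Submodule.finrank_mono (le_inf hR le_sup_left)
  rw [hcomp] at hX
  omega

end QuotientDimensions

section ZigzagBound

variable {K : Type} [Field K]
variable {A : ℤ → ℤ → Type} [∀ p q, AddCommGroup (A p q)] [∀ p q, Module K (A p q)]
variable {d1 : ∀ p q : ℤ, A p q →ₗ[K] A (p + 1) q} {d2 : ∀ p q : ℤ, A p q →ₗ[K] A p (q + 1)}

theorem range_dcCast_d1 {p p' q : ℤ} (h : p' + 1 = p + 1) :
    range ((dcCast K A h rfl).toLinearMap.comp (d1 p' q)) = range (d1 p q) := by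
  obtain rfl : p' = p := by omega
  rfl

theorem range_dcCast_d2 {p q q' : ℤ} (h : q' + 1 = q + 1) :
    range ((dcCast K A rfl h).toLinearMap.comp (d2 p q')) = range (d2 p q) := by
  obtain rfl : q' = q := by omega
  rfl

theorem range_dcCast_d1_le_ker (hd1d1 : ∀ (p q : ℤ) (x : A p q), d1 (p + 1) q (d1 p q x) = 0)
    {p p' q : ℤ} (h : p' + 1 = p) :
    range ((dcCast K A h rfl).toLinearMap.comp (d1 p' q)) ≤ ker (d1 p q) := by
  subst h
  rw [range_dcCast_d1]
  rintro _ ⟨x, rfl⟩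
  exact hd1d1 p' q x

theorem range_dcCast_d2_le_ker (hd2d2 : ∀ (p q : ℤ) (x : A p q), d2 p (q + 1) (d2 p q x) = 0)
    {p q q' : ℤ} (h : q' + 1 = q) :
    range ((dcCast K A rfl h).toLinearMap.comp (d2 p q')) ≤ ker (d2 p q) := by
  subst h
  rw [range_dcCast_d2]
  rintro _ ⟨x, rfl⟩
  exact hd2d2 p q' x

theorem ker_ddBar_eq
    (hanti : ∀ (p q : ℤ) (x : A p q), d1 p (q + 1) (d2 p q x) + d2 (p + 1) q (d1 p q x) = 0)
    (p q : ℤ) : ker (ddBar K A d1 d2 p q) = ker ((d2 (p + 1) q).comp (d1 p q)) := by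
  ext x
  have h := hanti p q x
  simp only [LinearMap.mem_ker, ddBar, LinearMap.comp_apply]
  constructor <;> intro hx <;> simpa [hx] using h

theorem aDen_le_ker_ddBar
    (hd1d1 : ∀ (p q : ℤ) (x : A p q), d1 (p + 1) q (d1 p q x) = 0)
    (hd2d2 : ∀ (p q : ℤ) (x : A p q), d2 p (q + 1) (d2 p q x) = 0)
    (hanti : ∀ (p q : ℤ) (x : A p q), d1 p (q + 1) (d2 p q x) + d2 (p + 1) q (d1 p q x) = 0)
    (p q : ℤ) : aDen K A d1 d2 p q ≤ ker (ddBar K A d1 d2 p q) := by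
  refine sup_le ?_ ?_
  · rw [ker_ddBar_eq hanti]
    exact (range_dcCast_d1_le_ker hd1d1 _).trans (LinearMap.ker_le_ker_comp _ _)
  · exact (range_dcCast_d2_le_ker hd2d2 _).trans (LinearMap.ker_le_ker_comp _ _)

theorem hA_add_finrank_aDen [∀ p q, FiniteDimensional K (A p q)]
    (hd1d1 : ∀ (p q : ℤ) (x : A p q), d1 (p + 1) q (d1 p q x) = 0)
    (hd2d2 : ∀ (p q : ℤ) (x : A p q), d2 p (q + 1) (d2 p q x) = 0)
    (hanti : ∀ (p q : ℤ) (x : A p q), d1 p (q + 1) (d2 p q x) + d2 (p + 1) q (d1 p q x) = 0)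
    (p q : ℤ) :
    hA K A d1 d2 p q + finrank K (aDen K A d1 d2 p q) = finrank K (ker (ddBar K A d1 d2 p q)) :=
  finrank_subquotient_add (aDen_le_ker_ddBar hd1d1 hd2d2 hanti p q)

theorem hRow_add_finrank_range [∀ p q, FiniteDimensional K (A p q)]
    (hd1d1 : ∀ (p q : ℤ) (x : A p q), d1 (p + 1) q (d1 p q x) = 0) (p q : ℤ) :
    hRow K A d1 (p + 1) q + finrank K (range (d1 p q)) = finrank K (ker (d1 (p + 1) q)) := by
  rw [← range_dcCast_d1 (show p + 1 - 1 + 1 = p + 1 by ring)]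
  exact finrank_subquotient_add (range_dcCast_d1_le_ker hd1d1 _)

theorem hDolb_add_finrank_range [∀ p q, FiniteDimensional K (A p q)]
    (hd2d2 : ∀ (p q : ℤ) (x : A p q), d2 p (q + 1) (d2 p q x) = 0) (p q : ℤ) :
    hDolb K A d2 p (q + 1) + finrank K (range (d2 p q)) = finrank K (ker (d2 p (q + 1))) := by
  rw [← range_dcCast_d2 (show q + 1 - 1 + 1 = q + 1 by ring)]
  exact finrank_subquotient_add (range_dcCast_d2_le_ker hd2d2 _)

theorem aDen_succ_right (p q : ℤ) : aDen K A d1 d2 p (q + 1) =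
    range ((dcCast K A (show p - 1 + 1 = p by ring) rfl).toLinearMap.comp (d1 (p - 1) (q + 1))) ⊔
      range (d2 p q) := by
  rw [aDen, range_dcCast_d2]

theorem aDen_succ_left (p q : ℤ) : aDen K A d1 d2 (p + 1) q =
    range (d1 p q) ⊔
      range ((dcCast K A rfl (show q - 1 + 1 = q by ring)).toLinearMap.comp
        (d2 (p + 1) (q - 1))) := by
  rw [aDen, range_dcCast_d1]

theorem hA_le_add_hA [∀ p q, FiniteDimensional K (A p q)]
    (hd1d1 : ∀ (p q : ℤ) (x : A p q), d1 (p + 1) q (d1 p q x) = 0)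
    (hd2d2 : ∀ (p q : ℤ) (x : A p q), d2 p (q + 1) (d2 p q x) = 0)
    (hanti : ∀ (p q : ℤ) (x : A p q), d1 p (q + 1) (d2 p q x) + d2 (p + 1) q (d1 p q x) = 0)
    (p q : ℤ) :
    hA K A d1 d2 p (q + 1) ≤ hRow K A d1 p (q + 1) + hDolb K A d2 (p + 1) (q + 1)
      + hA K A d1 d2 (p + 1) q := by
  have hX := hA_add_finrank_aDen hd1d1 hd2d2 hanti p (q + 1)
  have hY := hA_add_finrank_aDen hd1d1 hd2d2 hanti (p + 1) q
  have hRowX : hRow K A d1 p (q + 1) + _ = _ := finrank_subquotient_add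
    (range_dcCast_d1_le_ker hd1d1 (show p - 1 + 1 = p by ring) (q := q + 1))
  have hDolbB := hDolb_add_finrank_range hd2d2 (p + 1) q
  have hstep := finrank_zigzag_step (d2 p q) (d1 p q) (d1 p (q + 1)) (d2 (p + 1) q)
    (d2 (p + 1) (q + 1)) (hanti p q)
    (by rintro _ ⟨x, rfl⟩; exact hd2d2 _ _ x)
    _ (range_dcCast_d1_le_ker hd1d1 (show p - 1 + 1 = p by ring))
    _ (range_dcCast_d2_le_ker hd2d2 (show q - 1 + 1 = q by ring))
    (ker (ddBar K A d1 d2 (p + 1) q))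
    (by rintro x ⟨y, hy⟩
        simp only [LinearMap.mem_ker, ddBar, LinearMap.comp_apply]
        rw [← hy]
        exact hd1d1 _ _ y)
  rw [← ker_ddBar_eq hanti, ← aDen_succ_right, ← aDen_succ_left] at hstep
  omega

/-- Conjugation identifies row and column cohomology. -/
theorem hRow_eq_hDolb {A : ℤ → ℤ → Type} [∀ p q, AddCommGroup (A p q)] [∀ p q, Module ℂ (A p q)]
    [∀ p q, FiniteDimensional ℂ (A p q)]
    {d1 : ∀ p q : ℤ, A p q →ₗ[ℂ] A (p + 1) q} {d2 : ∀ p q : ℤ, A p q →ₗ[ℂ] A p (q + 1)}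
    (hd1d1 : ∀ (p q : ℤ) (x : A p q), d1 (p + 1) q (d1 p q x) = 0)
    (hd2d2 : ∀ (p q : ℤ) (x : A p q), d2 p (q + 1) (d2 p q x) = 0)
    (σ : ∀ p q : ℤ, A p q →ₛₗ[starRingEnd ℂ] A q p)
    (hσσ : ∀ (p q : ℤ) (x : A p q), σ q p (σ p q x) = x)
    (hσd : ∀ (p q : ℤ) (x : A p q), σ (p + 1) q (d1 p q x) = d2 q p (σ p q x)) (p q : ℤ) :
    hRow ℂ A d1 p q = hDolb ℂ A d2 q p := by
  have hinj : ∀ p q, Function.Injective (σ p q) := fun p q =>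
    Function.LeftInverse.injective (hσσ p q)
  have hA : ∀ p q, finrank ℂ (A p q) = finrank ℂ (A q p) := fun p q =>
    congrArg Cardinal.toNat <| rank_eq_of_equiv_equiv (starRingEnd ℂ)
      { toFun := σ p q, invFun := σ q p, left_inv := hσσ p q, right_inv := hσσ q p,
        map_add' := map_add _ } (starRingAut (R := ℂ)).bijective (fun r m => (σ p q).map_smulₛₗ r m)
  have hker : ∀ p q, finrank ℂ (ker (d1 p q)) = finrank ℂ (ker (d2 q p)) := fun p q =>
    congrArg Cardinal.toNat <| rank_eq_of_equiv_equiv (starRingEnd ℂ)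
      { toFun := fun x => ⟨σ p q x, by
          rw [LinearMap.mem_ker, ← hσd, LinearMap.mem_ker.1 x.2, map_zero]⟩
        invFun := fun x => ⟨σ q p x, by
          rw [LinearMap.mem_ker]
          apply hinj
          rw [hσd, hσσ, LinearMap.mem_ker.1 x.2, map_zero]⟩
        left_inv := fun x => Subtype.ext (hσσ p q x)
        right_inv := fun x => Subtype.ext (hσσ q p x)
        map_add' := fun x y => Subtype.ext (map_add _ _ _) }
      (starRingAut (R := ℂ)).bijective (fun r m => Subtype.ext ((σ p q).map_smulₛₗ r m))
  have hrange : ∀ p q, finrank ℂ (range (d1 p q)) = finrank ℂ (range (d2 q p)) := fun p q => by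
    have h1 := (d1 p q).finrank_range_add_finrank_ker
    have h2 := (d2 q p).finrank_range_add_finrank_ker
    have h3 := hA p q
    have h4 := hker p q
    omega
  obtain ⟨p, rfl⟩ : ∃ p', p = p' + 1 := ⟨p - 1, by ring⟩
  have h1 := hRow_add_finrank_range hd1d1 p q
  have h2 := hDolb_add_finrank_range hd2d2 q p
  have h3 := hker (p + 1) q
  have h4 := hrange p q
  omega

end ZigzagBound

/-- Telescoping a recursive bound `a p ≤ b p + a (p + 1)` for `a` vanishing beyond `n`. -/
theorem le_finsum_of_le_add_succ {a b : ℤ → ℕ} {m n : ℤ} (ha : ∀ p, n < p → a p = 0)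
    (hb : Function.support b ⊆ Finset.Icc m n) (h : ∀ p, a p ≤ b p + a (p + 1)) (p : ℤ) :
    a p ≤ ∑ᶠ i, b i := by
  have key : ∀ (j : ℕ) (p : ℤ), n < p + j → a p ≤ ∑ i ∈ Finset.Ico p (p + j), b i := by
    intro j
    induction j with
    | zero => intro p hp; simp [ha p (by simpa using hp)]
    | succ j ih =>
      intro p hp
      have h1 := ih (p + 1) (by push_cast at hp; omega)
      have h2 : Finset.Ico p (p + (j + 1 : ℕ)) = insert p (Finset.Ico (p + 1) (p + 1 + j)) := by
        ext i
        simp only [Finset.mem_Ico, Finset.mem_insert]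
        omega
      rw [h2, Finset.sum_insert (by simp)]
      have := h p
      omega
  refine (key (n + 1 - p).toNat p (by omega)).trans ?_
  rw [finsum_eq_sum_of_support_subset b
    (s := Finset.Icc m n ∪ Finset.Ico p (p + (n + 1 - p).toNat))
    (hb.trans (by exact_mod_cast Finset.subset_union_left))]
  exact Finset.sum_le_sum_of_subset Finset.subset_union_right

theorem aeppli_upper_bound (n : ℕ)
    (A : ℤ → ℤ → Type) [∀ p q, AddCommGroup (A p q)] [∀ p q, Module ℂ (A p q)]
    [∀ p q, FiniteDimensional ℂ (A p q)]
    (d1 : ∀ p q : ℤ, A p q →ₗ[ℂ] A (p + 1) q)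
    (d2 : ∀ p q : ℤ, A p q →ₗ[ℂ] A p (q + 1))
    (hsupp : ∀ p q : ℤ, (p < 0 ∨ (n : ℤ) < p ∨ q < 0 ∨ (n : ℤ) < q) → Subsingleton (A p q))
    (hd1d1 : ∀ (p q : ℤ) (x : A p q), d1 (p + 1) q (d1 p q x) = 0)
    (hd2d2 : ∀ (p q : ℤ) (x : A p q), d2 p (q + 1) (d2 p q x) = 0)
    (hanti : ∀ (p q : ℤ) (x : A p q), d1 p (q + 1) (d2 p q x) + d2 (p + 1) q (d1 p q x) = 0)
    (σ : ∀ p q : ℤ, A p q →ₛₗ[starRingEnd ℂ] A q p)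
    (hσσ : ∀ (p q : ℤ) (x : A p q), σ q p (σ p q x) = x)
    (hσd : ∀ (p q : ℤ) (x : A p q), σ (p + 1) q (d1 p q x) = d2 q p (σ p q x)) :
    ∀ k : ℤ,
      ((∑ᶠ p : ℤ, hA ℂ A d1 d2 p (k - p) : ℕ) : ℤ) ≤
        min (k + 1) (2 * (n : ℤ) - k + 1) *
          (((∑ᶠ p : ℤ, hDolb ℂ A d2 p (k - p) : ℕ) : ℤ) +
            ((∑ᶠ p : ℤ, hDolb ℂ A d2 p (k + 1 - p) : ℕ) : ℤ)) ∧
      ((∑ᶠ p : ℤ, hA ℂ A d1 d2 p (k - p) : ℕ) : ℤ) ≤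
        ((n : ℤ) + 1) *
          (((∑ᶠ p : ℤ, hDolb ℂ A d2 p (k - p) : ℕ) : ℤ) +
            ((∑ᶠ p : ℤ, hDolb ℂ A d2 p (k + 1 - p) : ℕ) : ℤ)) := by
  intro k
  have hA0 : ∀ p q : ℤ, (p < 0 ∨ (n : ℤ) < p ∨ q < 0 ∨ (n : ℤ) < q) → hA ℂ A d1 d2 p q = 0 := by
    intro p q h
    have := hsupp p q h
    exact finrank_zero_of_subsingleton
  have hD0 : ∀ p q : ℤ, (p < 0 ∨ (n : ℤ) < p ∨ q < 0 ∨ (n : ℤ) < q) → hDolb ℂ A d2 p q = 0 := by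
    intro p q h
    have := hsupp p q h
    exact finrank_zero_of_subsingleton
  set S₀ := ∑ᶠ p : ℤ, hDolb ℂ A d2 p (k - p) with hS₀
  set S₁ := ∑ᶠ p : ℤ, hDolb ℂ A d2 p (k + 1 - p) with hS₁
  have hbound : ∀ p : ℤ, hA ℂ A d1 d2 p (k - p) ≤ S₀ + S₁ := by
    have hr : ∀ p : ℤ, (p < 0 ∨ (n : ℤ) < p) → hDolb ℂ A d2 (k - p) p = 0 :=
      fun p hp => hD0 _ _ (by omega)
    have hc : ∀ p : ℤ, (p + 1 < 0 ∨ (n : ℤ) < p + 1) → hDolb ℂ A d2 (p + 1) (k - p) = 0 :=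
      fun p hp => hD0 _ _ (by omega)
    have hsum : ∑ᶠ p : ℤ, (hDolb ℂ A d2 (k - p) p + hDolb ℂ A d2 (p + 1) (k - p)) = S₀ + S₁ := by
      rw [finsum_add_distrib]
      · rw [hS₀, hS₁, ← finsum_comp_equiv (Equiv.subLeft k) (f := fun p => hDolb ℂ A d2 p (k - p)),
          ← finsum_comp_equiv (Equiv.addRight 1) (f := fun p => hDolb ℂ A d2 p (k + 1 - p))]
        simp
      · refine (Finset.Icc 0 (n : ℤ)).finite_toSet.subset fun p hp => ?_
        by_contra h
        exact hp (hr p (by simp at h; omega))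
      · refine (Finset.Icc (-1) (n : ℤ)).finite_toSet.subset fun p hp => ?_
        by_contra h
        exact hp (hc p (by simp at h; omega))
    rw [← hsum]
    refine le_finsum_of_le_add_succ (m := -1) (n := n) (fun p hp => hA0 _ _ (by omega)) ?_ ?_
    · intro p hp
      by_contra h
      simp only [Finset.coe_Icc, Set.mem_Icc] at h
      exact hp (by simp only [hr p (by omega), hc p (by omega), add_zero])
    · intro p
      have h := hA_le_add_hA hd1d1 hd2d2 hanti p (k - p - 1)
      rwa [sub_add_cancel, hRow_eq_hDolb hd1d1 hd2d2 σ hσσ hσd,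
        show k - p - 1 = k - (p + 1) by ring] at h
  have hmin : ((∑ᶠ p : ℤ, hA ℂ A d1 d2 p (k - p) : ℕ) : ℤ) ≤
      min (k + 1) (2 * (n : ℤ) - k + 1) * ((S₀ : ℤ) + (S₁ : ℤ)) := by
    have hsupport : Function.support (fun p : ℤ => hA ℂ A d1 d2 p (k - p)) ⊆
        Finset.Icc (max 0 (k - n)) (min k n) := by
      intro p hp
      by_contra h
      simp only [Finset.coe_Icc, Set.mem_Icc] at h
      exact hp (hA0 _ _ (by omega))
    rw [finsum_eq_sum_of_support_subset _ hsupport]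
    by_cases hk : 0 ≤ k ∧ k ≤ 2 * n
    · have h := Finset.sum_le_card_nsmul (Finset.Icc (max 0 (k - n)) (min k (n : ℤ))) _ _
        fun p _ => hbound p
      have hcard : ((Finset.Icc (max 0 (k - n)) (min k (n : ℤ))).card : ℤ) =
          min (k + 1) (2 * (n : ℤ) - k + 1) := by
        rw [Int.card_Icc]
        omega
      rw [← hcard]
      exact_mod_cast h
    · rw [Finset.Icc_eq_empty (by omega), Finset.sum_empty]
      have h₀ : S₀ = 0 := finsum_eq_zero_of_forall_eq_zero fun p => hD0 _ _ (by omega)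
      by_cases hk' : k = -1
      · rw [hk', min_eq_left (by omega)]
        simp
      · have h₁ : S₁ = 0 := finsum_eq_zero_of_forall_eq_zero fun p => hD0 _ _ (by omega)
        simp [h₀, h₁]
  refine ⟨hmin, hmin.trans (mul_le_mul_of_nonneg_right (by omega) (by positivity))⟩

end Paper
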